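/- arXiv:1312.0256 — 3 statements merged into one kernel-verified Lean document; each statement's English description precedes it below -/
import Mathlib

section
/- Let ρ ∈ [0,1], m̂ > 0 and χ̂ > 0. Let x⁰ be distributed according to the Bernoulli–Gaussian measure μ_ρ and let z be an independent standard Gaussian random variable. Then E[ x̂(√χ̂·z + m̂·x⁰; m̂)² ] = −(2(1−ρ)/m̂²)·r(χ̂) − (2ρ/m̂²)·r(χ̂ + m̂²). -/
open MeasureTheory ProbabilityTheory

/-- Standard Gaussian tail function `𝒬(x) = ∫_x^∞ e^{−z²/2}/√(2π) dz`. -/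
noncomputable def gaussQ (x : ℝ) : ℝ :=
  ∫ z in Set.Ioi x, Real.exp (-z ^ 2 / 2) / Real.sqrt (2 * Real.pi)

/-- `r(h) = √(h/(2π))·e^{−1/(2h)} − (1+h)·𝒬(1/√h)`. -/
noncomputable def rFun (h : ℝ) : ℝ :=
  Real.sqrt (h / (2 * Real.pi)) * Real.exp (-1 / (2 * h)) - (1 + h) * gaussQ (1 / Real.sqrt h)

/-- Soft-thresholding function: `x̂(y; Q̂)`. -/
noncomputable def softThresh (y Qh : ℝ) : ℝ :=
  if 1 < y then (y - 1) / Qh else if y < -1 then (y + 1) / Qh else 0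

/-- Bernoulli–Gaussian measure `μ_ρ = (1−ρ)·δ₀ + ρ·N(0,1)` on `ℝ`. -/
noncomputable def bgMeasure (ρ : ℝ) : Measure ℝ :=
  ENNReal.ofReal (1 - ρ) • Measure.dirac (0 : ℝ) + ENNReal.ofReal ρ • gaussianReal 0 1

lemma gaussianPDFReal_zero_one (z : ℝ) :
    gaussianPDFReal 0 1 z = Real.exp (-z ^ 2 / 2) / Real.sqrt (2 * Real.pi) := by
  simp [gaussianPDFReal, div_eq_inv_mul]

lemma hasDerivAt_gaussianPDFReal_zero_one (z : ℝ) :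
    HasDerivAt (gaussianPDFReal 0 1) (-z * gaussianPDFReal 0 1 z) z := by
  have h : HasDerivAt (fun x : ℝ => -x ^ 2 / 2) (-z) z := by
    refine (((hasDerivAt_id z).pow 2).neg.div_const 2).congr_deriv ?_
    simp [neg_div]
  rw [funext gaussianPDFReal_zero_one]
  refine (h.exp.div_const _).congr_deriv ?_
  ring

lemma integrable_pow_mul_gaussianPDFReal_zero_one (n : ℕ) :
    Integrable fun z : ℝ => z ^ n * gaussianPDFReal 0 1 z := by
  have h := (integrable_rpow_mul_exp_neg_mul_sq (b := 1 / 2) (by norm_num) (s := n)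
    (by linarith [n.cast_nonneg (α := ℝ)])).div_const (Real.sqrt (2 * Real.pi))
  refine h.congr (Filter.Eventually.of_forall fun z => ?_)
  simp only [gaussianPDFReal_zero_one, Real.rpow_natCast]
  rw [show -z ^ 2 / 2 = -(1 / 2) * z ^ 2 by ring]
  ring

lemma setIntegral_Ioi_sq_mul_gaussianPDFReal {s : ℝ} (hs : 0 < s) :
    ∫ z in Set.Ioi (1 / s), (s * z - 1) ^ 2 * gaussianPDFReal 0 1 z = -rFun (s ^ 2) := by
  have i0 := integrable_pow_mul_gaussianPDFReal_zero_one 0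
  have i1 := integrable_pow_mul_gaussianPDFReal_zero_one 1
  have i2 := integrable_pow_mul_gaussianPDFReal_zero_one 2
  simp only [pow_zero, one_mul, pow_one] at i0 i1
  have hd : ∀ z : ℝ, HasDerivAt (fun x => (2 * s - s ^ 2 * x) * gaussianPDFReal 0 1 x)
      ((s ^ 2 * z ^ 2 - 2 * s * z - s ^ 2) * gaussianPDFReal 0 1 z) z := fun z => by
    refine ((((hasDerivAt_id z).const_mul (s ^ 2)).const_sub (2 * s)).mul
      (hasDerivAt_gaussianPDFReal_zero_one z)).congr_deriv ?_
    simp only [id]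
    ring
  have hF : Integrable fun z : ℝ => (2 * s - s ^ 2 * z) * gaussianPDFReal 0 1 z := by
    refine ((i0.const_mul (2 * s)).sub (i1.const_mul (s ^ 2))).congr
      (Filter.Eventually.of_forall fun z => ?_)
    simp only [Pi.sub_apply]
    ring
  have hF' : Integrable fun z : ℝ =>
      (s ^ 2 * z ^ 2 - 2 * s * z - s ^ 2) * gaussianPDFReal 0 1 z := by
    refine (((i2.const_mul (s ^ 2)).sub (i1.const_mul (2 * s))).sub (i0.const_mul (s ^ 2))).congr
      (Filter.Eventually.of_forall fun z => ?_)
    simp only [Pi.sub_apply]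
    ring
  have hlim := tendsto_zero_of_hasDerivAt_of_integrableOn_Ioi (a := 1 / s) (fun z _ => hd z)
    hF'.integrableOn hF.integrableOn
  have hftc := integral_Ioi_of_hasDerivAt_of_tendsto' (a := 1 / s) (fun z _ => hd z)
    hF'.integrableOn hlim
  have hsplit : ∀ z : ℝ, (s * z - 1) ^ 2 * gaussianPDFReal 0 1 z =
      (s ^ 2 * z ^ 2 - 2 * s * z - s ^ 2) * gaussianPDFReal 0 1 z +
        (1 + s ^ 2) * gaussianPDFReal 0 1 z := fun z => by ring
  simp_rw [hsplit]
  rw [integral_add hF'.integrableOn (i0.const_mul _).integrableOn, hftc, integral_const_mul]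
  have hQ : ∫ z in Set.Ioi (1 / s), gaussianPDFReal 0 1 z = gaussQ (1 / s) := by
    simp_rw [gaussianPDFReal_zero_one]; rfl
  rw [hQ, rFun, Real.sqrt_sq hs.le, gaussianPDFReal_zero_one, Real.sqrt_div (sq_nonneg s),
    Real.sqrt_sq hs.le, show -(1 / s) ^ 2 / 2 = -1 / (2 * s ^ 2) by field_simp]
  field_simp
  ring

lemma softThresh_neg (y q : ℝ) : softThresh (-y) q = -softThresh y q := by
  unfold softThresh
  split_ifs <;> first | linarith | ring

lemma measurable_softThresh (q : ℝ) : Measurable fun y => softThresh y q := by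
  unfold softThresh
  exact Measurable.ite measurableSet_Ioi (by fun_prop)
    (Measurable.ite measurableSet_Iio (by fun_prop) measurable_const)

lemma abs_softThresh_le (y q : ℝ) : |softThresh y q| ≤ |y / q| := by
  unfold softThresh
  split_ifs with h1 h2
  · rw [abs_div, abs_div]
    gcongr ?_ / _
    exact abs_le_abs (by linarith) (by linarith)
  · rw [abs_div, abs_div]
    gcongr ?_ / _
    rw [abs_of_neg (by linarith), abs_of_neg (by linarith)]
    linarith
  · simp

lemma integrable_softThresh_sq_gaussianReal (μ : ℝ) (v : NNReal) (q : ℝ) :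
    Integrable (fun y => softThresh y q ^ 2) (gaussianReal μ v) := by
  have h : MemLp (fun y : ℝ => y / q) 2 (gaussianReal μ v) := by
    simpa [div_eq_inv_mul] using (memLp_id_gaussianReal (μ := μ) (v := v) 2).const_mul q⁻¹
  exact (h.mono (measurable_softThresh q).aestronglyMeasurable
    (Filter.Eventually.of_forall fun y => abs_softThresh_le y q)).integrable_sq

/-- The second moment of a soft-thresholded centred Gaussian with standard deviation `s`. -/
lemma integral_softThresh_sq_gaussianReal {s : ℝ} (hs : 0 < s) (q : ℝ) :
    ∫ z, softThresh (s * z) q ^ 2 ∂gaussianReal 0 1 = -(2 / q ^ 2) * rFun (s ^ 2) := by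
  rw [integral_gaussianReal_eq_integral_smul one_ne_zero]
  have habs : ∀ z : ℝ, gaussianPDFReal 0 1 z • softThresh (s * z) q ^ 2 =
      (fun x => gaussianPDFReal 0 1 x * softThresh (s * x) q ^ 2) |z| := fun z => by
    rcases abs_choice z with h | h
    · simp [h]
    · simp [h, softThresh_neg, gaussianPDFReal_zero_one]
  simp_rw [habs]
  rw [integral_comp_abs (f := fun x => gaussianPDFReal 0 1 x * softThresh (s * x) q ^ 2)]
  have h_indicator : ∀ z ∈ Set.Ioi (0 : ℝ), gaussianPDFReal 0 1 z * softThresh (s * z) q ^ 2 =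
      (Set.Ioi (1 / s)).indicator
        (fun x => (1 / q ^ 2) * ((s * x - 1) ^ 2 * gaussianPDFReal 0 1 x)) z := fun z hz => by
    have hz0 : 0 < s * z := mul_pos hs hz
    by_cases h : 1 / s < z
    · rw [Set.indicator_of_mem (show z ∈ Set.Ioi (1 / s) from h)]
      have : 1 < s * z := by rwa [div_lt_iff₀' hs] at h
      simp only [softThresh, this, if_true]
      ring
    · rw [Set.indicator_of_notMem (show z ∉ Set.Ioi (1 / s) from h)]
      have h1 : ¬ 1 < s * z := by rwa [div_lt_iff₀' hs] at h
      simp [softThresh, h1, show ¬ s * z < -1 by linarith]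
  rw [setIntegral_congr_fun measurableSet_Ioi h_indicator, setIntegral_indicator measurableSet_Ioi,
    Set.Ioi_inter_Ioi, sup_of_le_right (by positivity), integral_const_mul,
    setIntegral_Ioi_sq_mul_gaussianPDFReal hs]
  ring

lemma gaussianReal_zero_one_map_mul (s : ℝ) :
    (gaussianReal 0 1).map (s * ·) = gaussianReal 0 (s ^ 2).toNNReal := by
  rw [gaussianReal_map_const_mul, mul_zero, mul_one]
  congr 1
  exact (Real.toNNReal_of_nonneg (sq_nonneg s)).symm

lemma gaussianReal_prod_map_linear_comb (a b : ℝ) :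
    ((gaussianReal 0 1).prod (gaussianReal 0 1)).map (fun p : ℝ × ℝ => a * p.2 + b * p.1) =
      gaussianReal 0 (a ^ 2 + b ^ 2).toNNReal := by
  have h := gaussianReal_conv_gaussianReal (m₁ := 0) (m₂ := 0)
    (v₁ := (b ^ 2).toNNReal) (v₂ := (a ^ 2).toNNReal)
  rw [Measure.conv, ← gaussianReal_zero_one_map_mul, ← gaussianReal_zero_one_map_mul,
    Measure.map_prod_map _ _ (by fun_prop) (by fun_prop),
    Measure.map_map (by fun_prop) (by fun_prop), add_zero,
    ← Real.toNNReal_add (sq_nonneg _) (sq_nonneg _), add_comm (b ^ 2)] at h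
  rw [← h]
  congr 1
  ext p
  simp [add_comm]

/-- `E[x̂(√χ̂·z + m̂·x⁰; m̂)²] = −(2(1−ρ)/m̂²)·r(χ̂) − (2ρ/m̂²)·r(χ̂+m̂²)`
for `x⁰ ~ μ_ρ` and an independent standard Gaussian `z`. -/
theorem stmt_4 (ρ mh χh : ℝ) (hρ : ρ ∈ Set.Icc (0 : ℝ) 1) (hm : 0 < mh) (hχ : 0 < χh) :
    ∫ p : ℝ × ℝ, (softThresh (Real.sqrt χh * p.2 + mh * p.1) mh) ^ 2
        ∂((bgMeasure ρ).prod (gaussianReal 0 1)) =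
      -(2 * (1 - ρ) / mh ^ 2) * rFun χh - (2 * ρ / mh ^ 2) * rFun (χh + mh ^ 2) := by
  set L : ℝ × ℝ → ℝ := fun p => Real.sqrt χh * p.2 + mh * p.1 with hL
  have hLm : Measurable L := by fun_prop
  have hφ := (measurable_softThresh mh).pow_const 2
  have hmap0 : ((Measure.dirac (0 : ℝ)).prod (gaussianReal 0 1)).map L =
      gaussianReal 0 (Real.sqrt χh ^ 2).toNNReal := by
    rw [Measure.dirac_prod, Measure.map_map hLm (by fun_prop), ← gaussianReal_zero_one_map_mul]
    congr 1
    ext z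
    simp [hL]
  have hmap1 := gaussianReal_prod_map_linear_comb (Real.sqrt χh) mh
  have moment : ∀ (ν : Measure (ℝ × ℝ)) (s : ℝ), 0 < s →
      ν.map L = gaussianReal 0 (s ^ 2).toNNReal →
      Integrable (fun p => softThresh (L p) mh ^ 2) ν ∧
        ∫ p, softThresh (L p) mh ^ 2 ∂ν = -(2 / mh ^ 2) * rFun (s ^ 2) := by
    intro ν s hs hν
    constructor
    · refine Integrable.comp_measurable (f := L) (g := fun y => softThresh y mh ^ 2) ?_ hLm
      rw [hν]
      exact integrable_softThresh_sq_gaussianReal _ _ _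
    · rw [← integral_map (f := fun y => softThresh y mh ^ 2) hLm.aemeasurable
        hφ.aestronglyMeasurable, hν, ← gaussianReal_zero_one_map_mul,
        integral_map (by fun_prop) hφ.aestronglyMeasurable, integral_softThresh_sq_gaussianReal hs]
  have hsum : 0 < χh + mh ^ 2 := by positivity
  obtain ⟨j0, e0⟩ := moment _ _ (Real.sqrt_pos.2 hχ) hmap0
  obtain ⟨j1, e1⟩ := moment ((gaussianReal 0 1).prod (gaussianReal 0 1)) _ (Real.sqrt_pos.2 hsum)
    (by rw [Real.sq_sqrt hsum.le, ← Real.sq_sqrt hχ.le]; simpa [Real.sq_sqrt hχ.le] using hmap1)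
  rw [Real.sq_sqrt hχ.le] at e0
  rw [Real.sq_sqrt hsum.le] at e1
  rw [bgMeasure, Measure.add_prod, Measure.prod_smul_left, Measure.prod_smul_left,
    integral_add_measure (j0.smul_measure ENNReal.ofReal_ne_top)
      (j1.smul_measure ENNReal.ofReal_ne_top),
    integral_smul_measure, integral_smul_measure, e0, e1,
    ENNReal.toReal_ofReal (sub_nonneg.2 hρ.2), ENNReal.toReal_ofReal hρ.1, smul_eq_mul, smul_eq_mul]
  ring
end

section
/- Let ρ ∈ [0,1], m̂ > 0 and χ̂ > 0. Let x⁰ be distributed according to the Bernoulli–Gaussian measure μ_ρ and let z be an independent standard Gaussian random variable. Then (1/√χ̂)·E[ z · x̂(√χ̂·z + m̂·x⁰; m̂) ] = (2(1−ρ)/m̂)·𝒬(1/√χ̂) + (2ρ/m̂)·𝒬(1/√(χ̂ + m̂²)). -/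
open MeasureTheory ProbabilityTheory

/-- The Gaussian tail function is the upper tail of the standard Gaussian measure. -/
lemma gaussQ_eq_gaussianReal_real_Ioi (a : ℝ) :
    gaussQ a = (gaussianReal 0 1).real (Set.Ioi a) := by
  rw [measureReal_def, gaussianReal_apply_eq_integral 0 one_ne_zero,
    ENNReal.toReal_ofReal (integral_nonneg fun x => gaussianPDFReal_nonneg 0 1 x)]
  unfold gaussQ
  refine integral_congr_ae (Filter.Eventually.of_forall fun z => ?_)
  simp [gaussianPDFReal]
  ring

lemma integrable_sq_mul_gaussianPDFReal :
    Integrable fun z : ℝ => z ^ 2 * gaussianPDFReal 0 1 z := by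
  have h := (integrable_rpow_mul_exp_neg_mul_sq (b := 1 / 2) (by norm_num) (s := 2)
    (by norm_num)).const_mul (√(2 * Real.pi))⁻¹
  refine h.congr (Filter.Eventually.of_forall fun z => ?_)
  simp only [gaussianPDFReal, Real.rpow_ofNat, NNReal.coe_one, mul_one, sub_zero]
  rw [show -z ^ 2 / 2 = -(1 / 2) * z ^ 2 by ring]
  ring

lemma integrable_mul_gaussianPDFReal :
    Integrable fun z : ℝ => z * gaussianPDFReal 0 1 z := by
  have h := (integrable_mul_exp_neg_mul_sq (b := 1 / 2) (by norm_num)).const_mul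
    (√(2 * Real.pi))⁻¹
  refine h.congr (Filter.Eventually.of_forall fun z => ?_)
  simp only [gaussianPDFReal, NNReal.coe_one, mul_one, sub_zero]
  rw [show -z ^ 2 / 2 = -(1 / 2) * z ^ 2 by ring]
  ring

/-- Gaussian integration by parts on a half-line. -/
lemma setIntegral_Ioi_mul_sub_mul_gaussianPDFReal (a : ℝ) :
    ∫ z in Set.Ioi a, z * (z - a) * gaussianPDFReal 0 1 z = gaussQ a := by
  have h1 := integrable_mul_gaussianPDFReal
  have h2 := integrable_sq_mul_gaussianPDFReal
  have h0 := integrable_gaussianPDFReal 0 1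
  have hd : ∀ z, HasDerivAt (fun z => (z - a) * gaussianPDFReal 0 1 z)
      (gaussianPDFReal 0 1 z - z * (z - a) * gaussianPDFReal 0 1 z) z := by
    intro z
    refine (((hasDerivAt_id z).sub_const a).mul
      (hasDerivAt_gaussianPDFReal_zero_one z)).congr_deriv ?_
    simp only [id]
    ring
  have hf : Integrable fun z => (z - a) * gaussianPDFReal 0 1 z :=
    (h1.sub (h0.const_mul a)).congr (Filter.Eventually.of_forall fun z => by
      simp only [Pi.sub_apply]; ring)
  have hg : Integrable fun z => z * (z - a) * gaussianPDFReal 0 1 z :=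
    (h2.sub (h1.const_mul a)).congr (Filter.Eventually.of_forall fun z => by
      simp only [Pi.sub_apply]; ring)
  have hlim := tendsto_zero_of_hasDerivAt_of_integrableOn_Ioi (a := a)
    (fun z _ => hd z) (h0.sub hg).integrableOn hf.integrableOn
  have key := integral_Ioi_of_hasDerivAt_of_tendsto' (a := a)
    (fun z _ => hd z) (h0.sub hg).integrableOn hlim
  rw [integral_sub h0.integrableOn hg.integrableOn] at key
  have hQ : ∫ z in Set.Ioi a, gaussianPDFReal 0 1 z = gaussQ a := by
    unfold gaussQ
    refine integral_congr_ae (Filter.Eventually.of_forall fun z => ?_)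
    simp [gaussianPDFReal]
    ring
  rw [hQ] at key
  simp at key
  linarith

/-- Stein's identity for the positive part of an affine function. -/
lemma integral_mul_max_gaussianReal {s : ℝ} (hs : 0 < s) (c : ℝ) :
    ∫ z, z * max (s * z + c) 0 ∂(gaussianReal 0 1) = s * gaussQ (-c / s) := by
  rw [integral_gaussianReal_eq_integral_smul one_ne_zero,
    ← setIntegral_Ioi_mul_sub_mul_gaussianPDFReal, ← integral_const_mul,
    ← integral_indicator measurableSet_Ioi]
  refine integral_congr_ae (Filter.Eventually.of_forall fun z => ?_)
  simp only [smul_eq_mul]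
  by_cases hz : z ∈ Set.Ioi (-c / s)
  · rw [Set.indicator_of_mem hz]
    have h : -c < z * s := (div_lt_iff₀ hs).1 hz
    rw [max_eq_left (by linarith)]
    field_simp
    ring
  · rw [Set.indicator_of_notMem hz]
    have h : z * s ≤ -c := (le_div_iff₀ hs).1 (not_lt.1 hz)
    rw [max_eq_right (by linarith)]
    simp

lemma integral_mul_max_neg_gaussianReal {s : ℝ} (hs : 0 < s) (c : ℝ) :
    ∫ z, z * max (-(s * z) + c) 0 ∂(gaussianReal 0 1) = -(s * gaussQ (-c / s)) := by
  have hmap : (gaussianReal 0 1).map (fun x : ℝ => -x) = gaussianReal 0 1 := by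
    rw [gaussianReal_map_neg, neg_zero]
  conv_lhs => rw [← hmap]
  rw [integral_map (by fun_prop) (by fun_prop), ← integral_mul_max_gaussianReal hs,
    ← integral_neg]
  simp

lemma softThresh_eq_max_sub_max (y Qh : ℝ) :
    softThresh y Qh = Qh⁻¹ * (max (y - 1) 0 - max (-y - 1) 0) := by
  unfold softThresh
  split_ifs with h1 h2
  · rw [max_eq_left (by linarith), max_eq_right (by linarith)]; ring
  · rw [max_eq_right (by linarith), max_eq_left (by linarith)]; ring
  · rw [max_eq_right (by linarith), max_eq_right (by linarith)]; ring

lemma integrable_mul_max_prod {μ : Measure ℝ} [IsFiniteMeasure μ] (hμ : Integrable id μ)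
    (s m c : ℝ) :
    Integrable (fun p : ℝ × ℝ => p.2 * max (s * p.2 + m * p.1 + c) 0)
      (μ.prod (gaussianReal 0 1)) := by
  have hid : Integrable (fun z : ℝ => z) (gaussianReal 0 1) :=
    memLp_one_iff_integrable.1 (memLp_id_gaussianReal 1)
  have hsq : Integrable (fun z : ℝ => z ^ 2) (gaussianReal 0 1) :=
    (memLp_id_gaussianReal 2).integrable_sq
  have h1 := ((hsq.comp_snd μ).const_mul s).norm
  have h2 := ((hμ.mul_prod hid).const_mul m).norm
  have h3 := ((hid.comp_snd μ).const_mul c).norm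
  refine ((h1.add h2).add h3).mono' (by fun_prop) (Filter.Eventually.of_forall fun p => ?_)
  have hmax : |max (s * p.2 + m * p.1 + c) 0| ≤ |s * p.2 + m * p.1 + c| := by
    rw [abs_of_nonneg (le_max_right _ _)]
    exact max_le (le_abs_self _) (abs_nonneg _)
  simp only [Real.norm_eq_abs, Pi.add_apply, id]
  calc |p.2 * max (s * p.2 + m * p.1 + c) 0|
      ≤ |p.2| * |s * p.2 + m * p.1 + c| := by rw [abs_mul]; gcongr
    _ = |s * p.2 ^ 2 + m * (p.1 * p.2) + c * p.2| := by rw [← abs_mul]; ring_nf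
    _ ≤ _ := abs_add_three _ _ _

lemma integrable_mul_softThresh_prod {μ : Measure ℝ} [IsFiniteMeasure μ] (hμ : Integrable id μ)
    (s m Qh : ℝ) :
    Integrable (fun p : ℝ × ℝ => p.2 * softThresh (s * p.2 + m * p.1) Qh)
      (μ.prod (gaussianReal 0 1)) := by
  refine (((integrable_mul_max_prod hμ s m (-1)).sub
    (integrable_mul_max_prod hμ (-s) (-m) (-1))).const_mul Qh⁻¹).congr
    (Filter.Eventually.of_forall fun p => ?_)
  simp only [softThresh_eq_max_sub_max, Pi.sub_apply]
  ring_nf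

/-- Stein's identity for soft thresholding of an affine function. -/
lemma integral_mul_softThresh_gaussianReal {s : ℝ} (hs : 0 < s) (b Qh : ℝ) :
    ∫ z, z * softThresh (s * z + b) Qh ∂(gaussianReal 0 1) =
      s / Qh * (gaussQ ((1 - b) / s) + gaussQ ((1 + b) / s)) := by
  have hint : ∀ s c : ℝ, Integrable (fun z : ℝ => z * max (s * z + c) 0) (gaussianReal 0 1) := by
    intro s c
    have h := integrable_mul_max_prod (μ := Measure.dirac 0) (integrable_dirac (by simp)) s 0 c
    rw [Measure.dirac_prod, integrable_map_measure (by fun_prop) (by fun_prop)] at h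
    simpa [Function.comp_def] using h
  have h1 := hint s (b - 1)
  have h2 : Integrable (fun z : ℝ => z * max (-(s * z) + (-b - 1)) 0) (gaussianReal 0 1) := by
    simpa using hint (-s) (-b - 1)
  calc ∫ z, z * softThresh (s * z + b) Qh ∂(gaussianReal 0 1)
      = ∫ z, Qh⁻¹ * (z * max (s * z + (b - 1)) 0 - z * max (-(s * z) + (-b - 1)) 0)
          ∂(gaussianReal 0 1) := by
        congr 1 with z
        rw [softThresh_eq_max_sub_max]
        ring_nf
    _ = _ := by
        rw [integral_const_mul, integral_sub h1 h2, integral_mul_max_gaussianReal hs,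
          integral_mul_max_neg_gaussianReal hs]
        ring_nf

/-- Averaging a Gaussian tail over a Gaussian shift gives a Gaussian tail. -/
lemma integral_gaussQ_affine {s : ℝ} (hs : 0 < s) (m : ℝ) :
    ∫ x, gaussQ ((1 + m * x) / s) ∂(gaussianReal 0 1) = gaussQ (1 / √(s ^ 2 + m ^ 2)) := by
  set γ := gaussianReal 0 1
  set t := √(s ^ 2 + m ^ 2)
  have ht : 0 < t := by positivity
  have ht2 : t ^ 2 = s ^ 2 + m ^ 2 := Real.sq_sqrt (by positivity)
  have hind : IndepFun (fun p : ℝ × ℝ => -m * p.1) (fun p => s * p.2) (γ.prod γ) :=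
    indepFun_prod (X := fun x => -m * x) (Y := fun x => s * x) (by fun_prop) (by fun_prop)
  have hX : HasLaw (fun p : ℝ × ℝ => -m * p.1)
      (gaussianReal (-m * 0) (.mk ((-m) ^ 2) (sq_nonneg _) * 1)) (γ.prod γ) :=
    gaussianReal_const_mul ⟨by fun_prop, by simp [γ, Measure.map_fst_prod]⟩ (-m)
  have hY : HasLaw (fun p : ℝ × ℝ => s * p.2)
      (gaussianReal (s * 0) (.mk (s ^ 2) (sq_nonneg _) * 1)) (γ.prod γ) :=
    gaussianReal_const_mul ⟨by fun_prop, by simp [γ, Measure.map_snd_prod]⟩ s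
  have hlaw := (gaussianReal_add_gaussianReal_of_indepFun hind hX.map_eq hY.map_eq)
  have hT := gaussianReal_map_const_mul (μ := 0) (v := 1) t
  have heq : (γ.prod γ).map ((fun p : ℝ × ℝ => -m * p.1) + fun p => s * p.2) =
      γ.map (t * ·) := by
    rw [hlaw, hT]
    congr 1
    · simp
    · ext
      simp [ht2]
      ring
  have hmeas : MeasurableSet {p : ℝ × ℝ | 1 < -m * p.1 + s * p.2} :=
    measurableSet_lt (by fun_prop) (by fun_prop)
  calc ∫ x, gaussQ ((1 + m * x) / s) ∂γ
      = (γ.prod γ).real {p : ℝ × ℝ | 1 < -m * p.1 + s * p.2} := by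
        rw [measureReal_def, Measure.prod_apply hmeas, ← integral_toReal
          (measurable_measure_prodMk_left hmeas).aemeasurable
          (Filter.Eventually.of_forall fun x => measure_lt_top _ _)]
        congr 1 with x
        rw [gaussQ_eq_gaussianReal_real_Ioi, measureReal_def]
        congr 2
        ext z
        simp only [Set.mem_Ioi, div_lt_iff₀ hs, Set.mem_preimage, Set.mem_ofPred_eq]
        constructor <;> intro h <;> linarith
    _ = ((γ.prod γ).map ((fun p : ℝ × ℝ => -m * p.1) + fun p => s * p.2)).real (Set.Ioi 1) := by
        rw [map_measureReal_apply (by fun_prop) measurableSet_Ioi]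
        rfl
    _ = gaussQ (1 / t) := by
        rw [heq, map_measureReal_apply (by fun_prop) measurableSet_Ioi,
          gaussQ_eq_gaussianReal_real_Ioi]
        congr 1
        ext z
        simp only [Set.mem_preimage, Set.mem_Ioi, div_lt_iff₀ ht, mul_comm]

instance isFiniteMeasure_bgMeasure (ρ : ℝ) : IsFiniteMeasure (bgMeasure ρ) := by
  unfold bgMeasure
  have h1 := Measure.smul_finite (Measure.dirac (0 : ℝ)) (ENNReal.ofReal_ne_top (r := 1 - ρ))
  have h2 := Measure.smul_finite (gaussianReal 0 1) (ENNReal.ofReal_ne_top (r := ρ))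
  infer_instance

lemma integrable_bgMeasure {f : ℝ → ℝ} (hf : Integrable f (gaussianReal 0 1)) (ρ : ℝ) :
    Integrable f (bgMeasure ρ) :=
  ((integrable_dirac (by simp)).smul_measure ENNReal.ofReal_ne_top).add_measure
    (hf.smul_measure ENNReal.ofReal_ne_top)

lemma integral_bgMeasure {ρ : ℝ} (hρ : ρ ∈ Set.Icc (0 : ℝ) 1) {f : ℝ → ℝ}
    (hf : Integrable f (gaussianReal 0 1)) :
    ∫ x, f x ∂(bgMeasure ρ) = (1 - ρ) * f 0 + ρ * ∫ x, f x ∂(gaussianReal 0 1) := by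
  unfold bgMeasure
  rw [integral_add_measure ((integrable_dirac (by simp)).smul_measure ENNReal.ofReal_ne_top)
    (hf.smul_measure ENNReal.ofReal_ne_top), integral_smul_measure, integral_smul_measure,
    integral_dirac, ENNReal.toReal_ofReal (by linarith [hρ.2]), ENNReal.toReal_ofReal hρ.1]
  rfl

lemma integrable_gaussQ_comp {f : ℝ → ℝ} (hf : Measurable f) :
    Integrable (fun x => gaussQ (f x)) (gaussianReal 0 1) := by
  have hanti : Antitone gaussQ := fun a b hab => by
    rw [gaussQ_eq_gaussianReal_real_Ioi, gaussQ_eq_gaussianReal_real_Ioi]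
    exact measureReal_mono (Set.Ioi_subset_Ioi hab)
  refine Integrable.of_bound (hanti.measurable.comp hf).aestronglyMeasurable 1
    (Filter.Eventually.of_forall fun x => ?_)
  rw [gaussQ_eq_gaussianReal_real_Ioi, Real.norm_of_nonneg measureReal_nonneg]
  exact measureReal_le_one

/-- `(1/√χ̂)·E[z·x̂(√χ̂·z + m̂·x⁰; m̂)]
= (2(1−ρ)/m̂)·𝒬(1/√χ̂) + (2ρ/m̂)·𝒬(1/√(χ̂+m̂²))` for `x⁰ ~ μ_ρ` and an independent
standard Gaussian `z`. -/
theorem stmt_5 (ρ mh χh : ℝ) (hρ : ρ ∈ Set.Icc (0 : ℝ) 1) (hm : 0 < mh) (hχ : 0 < χh) :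
    (1 / Real.sqrt χh) *
        ∫ p : ℝ × ℝ, p.2 * softThresh (Real.sqrt χh * p.2 + mh * p.1) mh
          ∂((bgMeasure ρ).prod (gaussianReal 0 1)) =
      (2 * (1 - ρ) / mh) * gaussQ (1 / Real.sqrt χh) +
        (2 * ρ / mh) * gaussQ (1 / Real.sqrt (χh + mh ^ 2)) := by
  have hs : 0 < √χh := Real.sqrt_pos.2 hχ
  have hid : Integrable (id : ℝ → ℝ) (gaussianReal 0 1) :=
    memLp_one_iff_integrable.1 (memLp_id_gaussianReal 1)
  have h1 := integrable_gaussQ_comp (f := fun x => (1 - mh * x) / √χh) (by fun_prop)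
  have h2 := integrable_gaussQ_comp (f := fun x => (1 + mh * x) / √χh) (by fun_prop)
  have e1 := integral_gaussQ_affine hs (-mh)
  have e2 := integral_gaussQ_affine hs mh
  rw [Real.sq_sqrt hχ.le] at e1 e2
  simp only [neg_mul, ← sub_eq_add_neg, neg_sq] at e1
  rw [integral_prod _ (integrable_mul_softThresh_prod (integrable_bgMeasure hid ρ) _ _ _)]
  simp only [integral_mul_softThresh_gaussianReal hs]
  rw [integral_const_mul, integral_bgMeasure hρ (by exact h1.add h2), integral_add h1 h2, e1, e2]
  simp only [mul_zero, sub_zero, add_zero]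
  field_simp
  ring
end

section
/- Let ρ ∈ [0,1], m̂ > 0 and χ̂ > 0. Let x⁰ be distributed according to the Bernoulli–Gaussian measure μ_ρ and let z be an independent standard Gaussian random variable. Then E[ x̂₀(√χ̂·z + m̂·x⁰; m̂)² ] = 2(1−ρ)·(χ̂/m̂²)·r₀(m̂/χ̂) + 2ρ·((m̂² + χ̂)/m̂²)·r₀( m̂/(m̂² + χ̂) ). -/
open MeasureTheory ProbabilityTheory

/-- `r₀(h) = e^{−h}·√(h/π) + 𝒬(√(2h))`. -/
noncomputable def r0Fun (h : ℝ) : ℝ :=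
  Real.exp (-h) * Real.sqrt (h / Real.pi) + gaussQ (Real.sqrt (2 * h))

/-- Hard-thresholding function: `x̂₀(y; m̂) = y/m̂` if `|y| > √(2m̂)` and `0` otherwise. -/
noncomputable def hardThresh (y mh : ℝ) : ℝ :=
  if Real.sqrt (2 * mh) < |y| then y / mh else 0

open Filter Topology

lemma integrable_gaussian_density :
    Integrable (fun z : ℝ => Real.exp (-z ^ 2 / 2) / Real.sqrt (2 * Real.pi)) := by
  refine ((integrable_exp_neg_mul_sq (b := 1 / 2) (by norm_num)).div_const
    (Real.sqrt (2 * Real.pi))).congr (ae_of_all _ fun z => ?_)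
  simp only
  ring_nf

lemma integrable_sq_mul_gaussian_density :
    Integrable (fun z : ℝ => z ^ 2 * (Real.exp (-z ^ 2 / 2) / Real.sqrt (2 * Real.pi))) := by
  refine ((integrable_rpow_mul_exp_neg_mul_sq (b := 1 / 2) (by norm_num)
    (s := 2) (by norm_num)).div_const (Real.sqrt (2 * Real.pi))).congr (ae_of_all _ fun z => ?_)
  simp only [Real.rpow_two]
  ring_nf

lemma tendsto_mul_gaussian_density :
    Tendsto (fun z : ℝ => z * (Real.exp (-z ^ 2 / 2) / Real.sqrt (2 * Real.pi))) atTop (𝓝 0) := by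
  have h := ((tendsto_rpow_abs_mul_exp_neg_mul_sq_cocompact (a := 1 / 2) (by norm_num) 1).mono_left
    atTop_le_cocompact).div_const (Real.sqrt (2 * Real.pi))
  rw [zero_div] at h
  refine h.congr' ?_
  filter_upwards [eventually_ge_atTop 0] with z hz
  rw [Real.rpow_one, abs_of_nonneg hz]
  ring_nf

/-- Truncated second moment of the standard Gaussian. -/
lemma integral_Ioi_sq_mul_gaussian_density (a : ℝ) :
    ∫ z in Set.Ioi a, z ^ 2 * (Real.exp (-z ^ 2 / 2) / Real.sqrt (2 * Real.pi)) =
      a * (Real.exp (-a ^ 2 / 2) / Real.sqrt (2 * Real.pi)) + gaussQ a := by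
  set φ : ℝ → ℝ := fun z => Real.exp (-z ^ 2 / 2) / Real.sqrt (2 * Real.pi) with hφ
  have hd : ∀ z ∈ Set.Ici a, HasDerivAt (fun z => z * φ z) (φ z - z ^ 2 * φ z) z := by
    intro z _
    have h1 : HasDerivAt (fun z : ℝ => -z ^ 2 / 2) (-z) z :=
      ((hasDerivAt_pow 2 z).fun_neg.div_const 2).congr_deriv (by norm_num; ring)
    refine ((hasDerivAt_id' z).fun_mul
      (h1.exp.div_const (Real.sqrt (2 * Real.pi)))).congr_deriv ?_
    simp only [hφ]
    ring
  have h := integral_Ioi_of_hasDerivAt_of_tendsto' hd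
    (integrable_gaussian_density.sub integrable_sq_mul_gaussian_density).integrableOn
    tendsto_mul_gaussian_density
  rw [integral_sub integrable_gaussian_density.integrableOn
    integrable_sq_mul_gaussian_density.integrableOn] at h
  unfold gaussQ
  linarith

lemma measurable_hardThresh (mh : ℝ) : Measurable fun y => hardThresh y mh := by
  unfold hardThresh
  exact Measurable.ite (measurableSet_lt measurable_const measurable_id.abs)
    (measurable_id.div_const _) measurable_const

lemma integrable_hardThresh_sq (mh : ℝ) (v : NNReal) :
    Integrable (fun y => hardThresh y mh ^ 2) (gaussianReal 0 v) := by
  have h : Integrable (fun y : ℝ => (y / mh) ^ 2) (gaussianReal 0 v) := by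
    simpa [div_pow] using
      ((memLp_id_gaussianReal (μ := 0) (v := v) 2).integrable_sq).div_const (mh ^ 2)
  refine h.mono ((measurable_hardThresh mh).pow_const 2).aestronglyMeasurable
    (ae_of_all _ fun y => ?_)
  unfold hardThresh
  split_ifs
  · rfl
  · simpa using by positivity

/-- Second moment of the hard-thresholded centred Gaussian with variance `v`. -/
lemma integral_hardThresh_sq_gaussianReal {mh : ℝ} (hm : 0 < mh) {v : NNReal}
    (hv : 0 < (v : ℝ)) :
    ∫ y, hardThresh y mh ^ 2 ∂(gaussianReal 0 v) = 2 * (v / mh ^ 2) * r0Fun (mh / v) := by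
  set s := Real.sqrt v with hs
  have hs0 : 0 < s := Real.sqrt_pos.2 hv
  have hs2 : s ^ 2 = v := Real.sq_sqrt hv.le
  set a := Real.sqrt (2 * (mh / v)) with ha
  have ha2 : a ^ 2 = 2 * (mh / v) := Real.sq_sqrt (by positivity)
  have hsa : Real.sqrt (2 * mh) = s * a := by
    rw [ha, hs, ← Real.sqrt_mul hv.le]
    congr 1
    field_simp
  have hmap : gaussianReal 0 v = (gaussianReal 0 1).map (s * ·) := by
    rw [gaussianReal_map_const_mul]
    congr 1
    · simp
    · ext
      simp [hs2]
  set φ : ℝ → ℝ := fun z => Real.exp (-z ^ 2 / 2) / Real.sqrt (2 * Real.pi) with hφ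
  rw [hmap, integral_map (by fun_prop)
    ((measurable_hardThresh mh).pow_const 2).aestronglyMeasurable,
    integral_gaussianReal_eq_integral_smul one_ne_zero]
  have heven : ∀ z : ℝ, gaussianPDFReal 0 1 z • hardThresh (s * z) mh ^ 2 =
      (Set.Ioi a).indicator (fun z => v / mh ^ 2 * (z ^ 2 * φ z)) |z| := by
    intro z
    have hiff : Real.sqrt (2 * mh) < |s * z| ↔ |z| ∈ Set.Ioi a := by
      rw [hsa, abs_mul, abs_of_pos hs0, mul_lt_mul_iff_right₀ hs0, Set.mem_Ioi]
    by_cases hz : |z| ∈ Set.Ioi a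
    · rw [Set.indicator_of_mem hz, hardThresh, if_pos (hiff.2 hz), div_pow, mul_pow, hs2]
      simp only [gaussianPDFReal, hφ, sq_abs, smul_eq_mul, NNReal.coe_one, sub_zero, mul_one]
      ring
    · rw [Set.indicator_of_notMem hz, hardThresh, if_neg (mt hiff.1 hz)]
      simp
  simp_rw [heven]
  rw [integral_comp_abs (f := (Set.Ioi a).indicator fun z => v / mh ^ 2 * (z ^ 2 * φ z)),
    setIntegral_indicator measurableSet_Ioi, Set.Ioi_inter_Ioi,
    sup_eq_right.2 (Real.sqrt_nonneg _), integral_const_mul,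
    integral_Ioi_sq_mul_gaussian_density, r0Fun, ← ha]
  have hexp : -a ^ 2 / 2 = -(mh / v) := by rw [ha2]; ring
  have hsqrt : a / Real.sqrt (2 * Real.pi) = Real.sqrt (mh / v / Real.pi) := by
    rw [ha, ← Real.sqrt_div' _ (by positivity)]
    congr 1
    field_simp
  rw [hexp, ← hsqrt]
  ring

/-- A linear combination of two independent standard Gaussians is Gaussian. -/
lemma map_mul_add_mul_gaussianReal (a b : ℝ) (v : NNReal) (hv : (v : ℝ) = a ^ 2 + b ^ 2) :
    ((gaussianReal 0 1).prod (gaussianReal 0 1)).map (fun p : ℝ × ℝ => b * p.2 + a * p.1) =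
      gaussianReal 0 v := by
  have hlaw (c : ℝ) (f : ℝ × ℝ → ℝ) (hf : Measurable f)
      (hm : ((gaussianReal 0 1).prod (gaussianReal 0 1)).map f = gaussianReal 0 1) :
      ((gaussianReal 0 1).prod (gaussianReal 0 1)).map (fun p => c * f p) =
        gaussianReal 0 (.mk (c ^ 2) (sq_nonneg _)) := by
    have := Measure.map_map (μ := (gaussianReal 0 1).prod (gaussianReal 0 1))
      (measurable_const_mul c) hf
    rw [hm, gaussianReal_map_const_mul] at this
    simpa [Function.comp_def] using this.symm
  have hind : IndepFun (fun p : ℝ × ℝ => b * p.2) (fun p : ℝ × ℝ => a * p.1)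
      ((gaussianReal 0 1).prod (gaussianReal 0 1)) :=
    (indepFun_prod (measurable_const_mul a) (measurable_const_mul b)).symm
  have h := gaussianReal_add_gaussianReal_of_indepFun hind
    (hlaw b Prod.snd measurable_snd Measure.snd_prod)
    (hlaw a Prod.fst measurable_fst Measure.fst_prod)
  have hvar : v = .mk (b ^ 2) (sq_nonneg _) + .mk (a ^ 2) (sq_nonneg _) := by
    ext
    rw [hv, add_comm]
    rfl
  rw [hvar]
  simpa only [add_zero] using! h

/-- `E[x̂₀(√χ̂·z + m̂·x⁰; m̂)²]
= 2(1−ρ)·(χ̂/m̂²)·r₀(m̂/χ̂) + 2ρ·((m̂²+χ̂)/m̂²)·r₀(m̂/(m̂²+χ̂))` for `x⁰ ~ μ_ρ` and an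
independent standard Gaussian `z`. -/
theorem stmt_11 (ρ mh χh : ℝ) (hρ : ρ ∈ Set.Icc (0 : ℝ) 1) (hm : 0 < mh) (hχ : 0 < χh) :
    ∫ p : ℝ × ℝ, (hardThresh (Real.sqrt χh * p.2 + mh * p.1) mh) ^ 2
        ∂((bgMeasure ρ).prod (gaussianReal 0 1)) =
      2 * (1 - ρ) * (χh / mh ^ 2) * r0Fun (mh / χh) +
        2 * ρ * ((mh ^ 2 + χh) / mh ^ 2) * r0Fun (mh / (mh ^ 2 + χh)) := by
  obtain ⟨hρ0, hρ1⟩ := hρ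
  have hmeas : Measurable fun p : ℝ × ℝ => Real.sqrt χh * p.2 + mh * p.1 := by fun_prop
  have hsq := (measurable_hardThresh mh).pow_const 2
  have hpos : 0 < mh ^ 2 + χh := by positivity
  obtain ⟨u, hu⟩ : ∃ u : NNReal, (u : ℝ) = χh := ⟨⟨χh, hχ.le⟩, rfl⟩
  obtain ⟨w, hw⟩ : ∃ w : NNReal, (w : ℝ) = mh ^ 2 + χh := ⟨⟨mh ^ 2 + χh, hpos.le⟩, rfl⟩
  have hdirac : ((Measure.dirac (0 : ℝ)).prod (gaussianReal 0 1)).map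
      (fun p : ℝ × ℝ => Real.sqrt χh * p.2 + mh * p.1) = gaussianReal 0 u := by
    rw [Measure.dirac_prod, Measure.map_map hmeas measurable_prodMk_left]
    have h := gaussianReal_map_const_mul (μ := 0) (v := 1) (Real.sqrt χh)
    have hvar : u = .mk (Real.sqrt χh ^ 2) (sq_nonneg _) := by
      ext
      rw [hu, NNReal.coe_mk, Real.sq_sqrt hχ.le]
    simpa [Function.comp_def, hvar] using h
  have hgauss := map_mul_add_mul_gaussianReal mh (Real.sqrt χh) w
    (by simp [hw, Real.sq_sqrt hχ.le])
  have hint {ν : Measure (ℝ × ℝ)} {v : NNReal}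
      (hν : ν.map (fun p : ℝ × ℝ => Real.sqrt χh * p.2 + mh * p.1) = gaussianReal 0 v) :
      Integrable (fun p : ℝ × ℝ => hardThresh (Real.sqrt χh * p.2 + mh * p.1) mh ^ 2) ν :=
    (integrable_map_measure hsq.aestronglyMeasurable hmeas.aemeasurable).1
      (hν ▸ integrable_hardThresh_sq mh v)
  have hval {ν : Measure (ℝ × ℝ)} {v : NNReal} (hv : 0 < (v : ℝ))
      (hν : ν.map (fun p : ℝ × ℝ => Real.sqrt χh * p.2 + mh * p.1) = gaussianReal 0 v) :
      ∫ p : ℝ × ℝ, hardThresh (Real.sqrt χh * p.2 + mh * p.1) mh ^ 2 ∂ν =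
        2 * (v / mh ^ 2) * r0Fun (mh / v) := by
    rw [← integral_map (f := fun y => hardThresh y mh ^ 2) hmeas.aemeasurable
      hsq.aestronglyMeasurable, hν, integral_hardThresh_sq_gaussianReal hm hv]
  rw [bgMeasure, Measure.add_prod, Measure.prod_smul_left, Measure.prod_smul_left,
    integral_add_measure ((hint hdirac).smul_measure ENNReal.ofReal_ne_top)
      ((hint hgauss).smul_measure ENNReal.ofReal_ne_top),
    integral_smul_measure, integral_smul_measure, hval (hu ▸ hχ) hdirac, hval (hw ▸ hpos) hgauss,
    ENNReal.toReal_ofReal hρ0, ENNReal.toReal_ofReal (sub_nonneg.2 hρ1)]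
  rw [hu, hw, smul_eq_mul, smul_eq_mul]
  ring
end
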